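/- Let l ∈ ℕ, let q ∈ ℂ∖{0} with qᵐ ≠ 1 for 1 ≤ m ≤ l, and let a, b, c, d ∈ ℂ∖{0} with (ab;q)_l ≠ 0, (ac;q)_l ≠ 0 and (ad;q)_l ≠ 0. Define R_l(x) := Σ_{n=0}^{l} ((q^{−l};q)_n (abcdq^{l−1};q)_n (ax;q)_n (ax⁻¹;q)_n)/((q;q)_n (ab;q)_n (ac;q)_n (ad;q)_n) qⁿ and A⁺(x) := ((1 − ax)(1 − bx)(1 − cx)(1 − dx))/((1 − x²)(1 − qx²)). Then for every x ∈ ℂ∖{0} with x² ∉ {1, q, q⁻¹}: A⁺(x)(R_l(qx) − R_l(x)) + A⁺(x⁻¹)(R_l(q⁻¹x) − R_l(x)) = −(1 − q^{−l})(1 − q^{l−1}abcd) · R_l(x). -/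

import Mathlib

/-- The finite `q`-shifted factorial `(a;q)_n`. -/
noncomputable def qpoch (a q : ℂ) (n : ℕ) : ℂ := ∏ j ∈ Finset.range n, (1 - a * q ^ j)

/-- The Askey–Wilson coefficient `A⁺(x)`. -/
noncomputable def Aplus (a b c d q x : ℂ) : ℂ :=
  ((1 - a * x) * (1 - b * x) * (1 - c * x) * (1 - d * x)) / ((1 - x ^ 2) * (1 - q * x ^ 2))

/-- The (normalized) Askey–Wilson polynomial
`R_l(x) = Σ_{n=0}^{l} ((q^{-l};q)_n (abcdq^{l-1};q)_n (ax;q)_n (ax⁻¹;q)_n)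
  / ((q;q)_n (ab;q)_n (ac;q)_n (ad;q)_n) · qⁿ`. -/
noncomputable def AWR (q a b c d : ℂ) (l : ℕ) (x : ℂ) : ℂ :=
  ∑ n ∈ Finset.range (l + 1),
    (qpoch ((q⁻¹) ^ l) q n * qpoch (a * b * c * d * q ^ l * q⁻¹) q n *
        qpoch (a * x) q n * qpoch (a * x⁻¹) q n) /
      (qpoch q q n * qpoch (a * b) q n * qpoch (a * c) q n * qpoch (a * d) q n) * q ^ n

/-- The basis function `(ax;q)_n (ax⁻¹;q)_n`. -/
noncomputable def awBasis (a q : ℂ) (n : ℕ) (x : ℂ) : ℂ := qpoch (a * x) q n * qpoch (a * x⁻¹) q n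

/-- The coefficient of `awBasis a q n` in the Askey–Wilson polynomial `AWR q a b c d l`. -/
noncomputable def awCoeff (q a b c d : ℂ) (l n : ℕ) : ℂ :=
  (qpoch ((q⁻¹) ^ l) q n * qpoch (a * b * c * d * q ^ l * q⁻¹) q n) /
    (qpoch q q n * qpoch (a * b) q n * qpoch (a * c) q n * qpoch (a * d) q n) * q ^ n

/-- The eigenvalue of the Askey–Wilson operator in degree `n`. -/
noncomputable def awEigenvalue (q a b c d : ℂ) (n : ℕ) : ℂ :=
  -((1 - (q⁻¹) ^ n) * (1 - q ^ n * q⁻¹ * a * b * c * d))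

/-- The coefficient of `awBasis a q n` in the image of `awBasis a q (n + 1)` under the
Askey–Wilson operator. -/
noncomputable def awLower (q a b c d : ℂ) (n : ℕ) : ℂ :=
  -((q⁻¹) ^ (n + 1) * (1 - q ^ (n + 1)) * (1 - a * b * q ^ n) * (1 - a * c * q ^ n) *
    (1 - a * d * q ^ n))

theorem qpoch_zero (a q : ℂ) : qpoch a q 0 = 1 := by simp [qpoch]

theorem qpoch_succ (a q : ℂ) (n : ℕ) : qpoch a q (n + 1) = qpoch a q n * (1 - a * q ^ n) :=
  Finset.prod_range_succ _ _

theorem qpoch_succ' (a q : ℂ) (n : ℕ) :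
    qpoch a q (n + 1) = (1 - a) * qpoch (a * q) q n := by
  simp only [qpoch]
  rw [Finset.prod_range_succ', mul_comm]
  congr 1
  · simp
  · refine Finset.prod_congr rfl fun j _ => ?_
    ring

theorem qpoch_ne_zero_of_le {a q : ℂ} {n l : ℕ} (h : qpoch a q l ≠ 0) (hn : n ≤ l) :
    qpoch a q n ≠ 0 := by
  rw [qpoch, Finset.prod_ne_zero_iff] at *
  exact fun j hj => h j (Finset.range_subset_range.2 hn hj)

theorem qpoch_self_ne_zero {q : ℂ} {l : ℕ} (h : ∀ m : ℕ, 1 ≤ m → m ≤ l → q ^ m ≠ 1) :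
    qpoch q q l ≠ 0 := by
  rw [qpoch, Finset.prod_ne_zero_iff]
  intro j hj
  rw [← pow_succ']
  exact sub_ne_zero.2 (h (j + 1) (by omega) (Finset.mem_range.1 hj)).symm

theorem awBasis_inv (a q : ℂ) (n : ℕ) (x : ℂ) : awBasis a q n x⁻¹ = awBasis a q n x := by
  rw [awBasis, awBasis, inv_inv, mul_comm]

theorem awBasis_succ (a q : ℂ) (n : ℕ) (x : ℂ) :
    awBasis a q (n + 1) x =
      awBasis a q n x * ((1 - a * x * q ^ n) * (1 - a * x⁻¹ * q ^ n)) := by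
  simp only [awBasis, qpoch_succ]
  ring

theorem mul_awBasis_succ_shift {q : ℂ} (hq : q ≠ 0) (a : ℂ) (n : ℕ) (x : ℂ) :
    (1 - a * x) * awBasis a q (n + 1) (q * x) =
      awBasis a q n x *
        ((1 - a * x * q ^ n) * (1 - a * x * q ^ (n + 1)) * (1 - a * (q * x)⁻¹)) := by
  have e₁ : (1 - a * x) * qpoch (a * (q * x)) q (n + 1) =
      qpoch (a * x) q n * (1 - a * x * q ^ n) * (1 - a * x * q ^ (n + 1)) := by
    rw [← qpoch_succ, ← qpoch_succ, qpoch_succ' (a * x), mul_left_comm a, mul_comm q]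
  have e₂ : qpoch (a * (q * x)⁻¹) q (n + 1) = (1 - a * (q * x)⁻¹) * qpoch (a * x⁻¹) q n := by
    rw [qpoch_succ', mul_inv, mul_assoc, mul_right_comm, inv_mul_cancel₀ hq, one_mul]
  rw [awBasis, ← mul_assoc, e₁, e₂, awBasis]
  ring

theorem Aplus_mul_awBasis_sub {q : ℂ} (hq : q ≠ 0) (a b c d : ℂ) (n : ℕ) (x : ℂ) :
    Aplus a b c d q x * (awBasis a q (n + 1) (q * x) - awBasis a q (n + 1) x) =
      awBasis a q n x * (((1 - b * x) * (1 - c * x) * (1 - d * x)) /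
        ((1 - x ^ 2) * (1 - q * x ^ 2)) * ((1 - a * x * q ^ n) *
          ((1 - a * x * q ^ (n + 1)) * (1 - a * (q * x)⁻¹) -
            (1 - a * x) * (1 - a * x⁻¹ * q ^ n)))) := by
  have h := mul_awBasis_succ_shift hq a n x
  rw [Aplus, awBasis_succ a q n x]
  linear_combination ((1 - b * x) * (1 - c * x) * (1 - d * x)) /
        ((1 - x ^ 2) * (1 - q * x ^ 2)) * h

/-- The Askey–Wilson operator is bidiagonal on the functions `awBasis a q n`. -/
theorem awOperator_awBasis_succ {q : ℂ} (hq : q ≠ 0) (a b c d : ℂ) (n : ℕ) {x : ℂ}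
    (hx : x ≠ 0) (h1 : x ^ 2 ≠ 1) (h2 : x ^ 2 ≠ q) (h3 : x ^ 2 ≠ q⁻¹) :
    Aplus a b c d q x * (awBasis a q (n + 1) (q * x) - awBasis a q (n + 1) x)
      + Aplus a b c d q x⁻¹ * (awBasis a q (n + 1) (q⁻¹ * x) - awBasis a q (n + 1) x)
      = awEigenvalue q a b c d (n + 1) * awBasis a q (n + 1) x
        + awLower q a b c d n * awBasis a q n x := by
  have hinv : awBasis a q (n + 1) (q⁻¹ * x) = awBasis a q (n + 1) (q * x⁻¹) := by
    rw [← awBasis_inv, mul_inv, inv_inv]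
  rw [hinv, ← awBasis_inv a q (n + 1) x, Aplus_mul_awBasis_sub hq a b c d n x⁻¹,
    awBasis_inv, awBasis_inv, Aplus_mul_awBasis_sub hq, awBasis_succ, awEigenvalue, awLower]
  have g1 : 1 - x ^ 2 ≠ 0 := sub_ne_zero.2 h1.symm
  have g2 : x ^ 2 - q ≠ 0 := sub_ne_zero.2 h2
  have g3 : 1 - q * x ^ 2 ≠ 0 := fun h => h3 (eq_inv_of_mul_eq_one_right (sub_eq_zero.1 h).symm)
  have k1 : 1 - x⁻¹ ^ 2 = (x ^ 2 - 1) / x ^ 2 := by field_simp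
  have k2 : 1 - q * x⁻¹ ^ 2 = (x ^ 2 - q) / x ^ 2 := by field_simp
  have hQ : q ^ n ≠ 0 := pow_ne_zero n hq
  rw [k1, k2]
  simp only [inv_pow, pow_succ q n]
  generalize q ^ n = Q at *
  generalize awBasis a q n x = B
  rw [show x ^ 2 - 1 = -(1 - x ^ 2) by ring]
  obtain ⟨E, hE⟩ : ∃ E, E = 1 - x ^ 2 := ⟨_, rfl⟩
  obtain ⟨F, hF⟩ : ∃ F, F = 1 - q * x ^ 2 := ⟨_, rfl⟩
  obtain ⟨G, hG⟩ : ∃ G, G = x ^ 2 - q := ⟨_, rfl⟩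
  rw [← hE] at g1
  rw [← hF] at g3
  rw [← hG] at g2
  rw [← hE, ← hF, ← hG]
  field_simp
  rw [hE, hF, hG]
  ring

theorem awCoeff_succ_mul_awLower {q a b c d : ℂ} (hq : q ≠ 0) {l n : ℕ}
    (hqq : qpoch q q (n + 1) ≠ 0) (hab : qpoch (a * b) q (n + 1) ≠ 0)
    (hac : qpoch (a * c) q (n + 1) ≠ 0) (had : qpoch (a * d) q (n + 1) ≠ 0) :
    awCoeff q a b c d l (n + 1) * awLower q a b c d n =
      (awEigenvalue q a b c d l - awEigenvalue q a b c d n) * awCoeff q a b c d l n := by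
  rw [qpoch_succ, mul_ne_zero_iff] at hqq hab hac had
  obtain ⟨p1, p2⟩ := hqq
  obtain ⟨p3, p4⟩ := hab
  obtain ⟨p5, p6⟩ := hac
  obtain ⟨p7, p8⟩ := had
  have hQ : q ^ n ≠ 0 := pow_ne_zero n hq
  have hL : q ^ l ≠ 0 := pow_ne_zero l hq
  simp only [awCoeff, awLower, awEigenvalue, qpoch_succ, inv_pow, pow_succ q n]
  generalize qpoch q q n = u1 at *
  generalize qpoch (a * b) q n = u2 at *
  generalize qpoch (a * c) q n = u3 at *
  generalize qpoch (a * d) q n = u4 at *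
  generalize qpoch (q ^ l)⁻¹ q n = u5 at *
  generalize qpoch (a * b * c * d * q ^ l * q⁻¹) q n = u6 at *
  generalize q ^ n = Q at *
  generalize q ^ l = L at *
  rw [mul_comm Q q]
  generalize 1 - q * Q = v1 at *
  generalize 1 - a * b * Q = v2 at *
  generalize 1 - a * c * Q = v3 at *
  generalize 1 - a * d * Q = v4 at *
  field_simp
  ring

theorem AWR_eq_sum (q a b c d : ℂ) (l : ℕ) (x : ℂ) :
    AWR q a b c d l x =
      ∑ n ∈ Finset.range (l + 1), awCoeff q a b c d l n * awBasis a q n x := by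
  refine Finset.sum_congr rfl fun n _ => ?_
  rw [awCoeff, awBasis]
  ring

/-- The Askey–Wilson second-order `q`-difference operator has the Askey–Wilson
polynomial as eigenfunction, with eigenvalue `-(1 - q^{-l})(1 - q^{l-1}abcd)`. -/
theorem stmt_17 (q a b c d : ℂ) (hq : q ≠ 0) (l : ℕ)
    (hq1 : ∀ m : ℕ, 1 ≤ m → m ≤ l → q ^ m ≠ 1)
    (ha : a ≠ 0) (hb : b ≠ 0) (hc : c ≠ 0) (hd : d ≠ 0)
    (hab : qpoch (a * b) q l ≠ 0) (hac : qpoch (a * c) q l ≠ 0)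
    (had : qpoch (a * d) q l ≠ 0)
    (x : ℂ) (hx : x ≠ 0) (h1 : x ^ 2 ≠ 1) (h2 : x ^ 2 ≠ q) (h3 : x ^ 2 ≠ q⁻¹) :
    Aplus a b c d q x * (AWR q a b c d l (q * x) - AWR q a b c d l x)
      + Aplus a b c d q x⁻¹ * (AWR q a b c d l (q⁻¹ * x) - AWR q a b c d l x)
      = -((1 - (q⁻¹) ^ l) * (1 - q ^ l * q⁻¹ * a * b * c * d)) * AWR q a b c d l x := by
  have hqq := qpoch_self_ne_zero hq1
  have hsum : Aplus a b c d q x * (AWR q a b c d l (q * x) - AWR q a b c d l x)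
      + Aplus a b c d q x⁻¹ * (AWR q a b c d l (q⁻¹ * x) - AWR q a b c d l x)
      = ∑ n ∈ Finset.range (l + 1), awCoeff q a b c d l n *
        (Aplus a b c d q x * (awBasis a q n (q * x) - awBasis a q n x)
          + Aplus a b c d q x⁻¹ * (awBasis a q n (q⁻¹ * x) - awBasis a q n x)) := by
    simp only [AWR_eq_sum, ← Finset.sum_sub_distrib, Finset.mul_sum, ← Finset.sum_add_distrib]
    refine Finset.sum_congr rfl fun n _ => ?_
    ring
  have hzero : Aplus a b c d q x * (awBasis a q 0 (q * x) - awBasis a q 0 x)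
      + Aplus a b c d q x⁻¹ * (awBasis a q 0 (q⁻¹ * x) - awBasis a q 0 x)
      = awEigenvalue q a b c d 0 * awBasis a q 0 x := by
    simp [awBasis, qpoch_zero, awEigenvalue]
  have hstep : ∀ n ∈ Finset.range l, awCoeff q a b c d l (n + 1) *
      (awEigenvalue q a b c d (n + 1) * awBasis a q (n + 1) x
        + awLower q a b c d n * awBasis a q n x) =
      awCoeff q a b c d l (n + 1) * awEigenvalue q a b c d (n + 1) * awBasis a q (n + 1) x
        + (awEigenvalue q a b c d l - awEigenvalue q a b c d n) * awCoeff q a b c d l n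
          * awBasis a q n x := by
    intro n hn
    have hn' : n + 1 ≤ l := Finset.mem_range.1 hn
    rw [← awCoeff_succ_mul_awLower hq (qpoch_ne_zero_of_le hqq hn')
      (qpoch_ne_zero_of_le hab hn') (qpoch_ne_zero_of_le hac hn') (qpoch_ne_zero_of_le had hn')]
    ring
  rw [hsum, Finset.sum_range_succ', hzero]
  simp only [awOperator_awBasis_succ hq a b c d _ hx h1 h2 h3]
  rw [Finset.sum_congr rfl hstep, Finset.sum_add_distrib, add_right_comm, ← mul_assoc,
    ← Finset.sum_range_succ' fun n =>
      awCoeff q a b c d l n * awEigenvalue q a b c d n * awBasis a q n x,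
    Finset.sum_range_succ, add_right_comm, ← Finset.sum_add_distrib, AWR_eq_sum,
    Finset.sum_range_succ, mul_add, Finset.mul_sum]
  congr 1
  · refine Finset.sum_congr rfl fun n _ => ?_
    simp only [awEigenvalue]
    ring
  · simp only [awEigenvalue]
    ring
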